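/- There exist sets A B : Set ℝ such that: A ∪ B = {x : ℝ | x is a computable real ∧ x ∈ Icc 0 1}; A ∩ B = ∅; A and B are both nonempty; and both A and B are sequentially closed with respect to computable limits, i.e. for every sequence u : ℕ → ℝ with all u n ∈ A (respectively all u n ∈ B), if u tends to a limit x which is a computable real, then x ∈ A (respectively x ∈ B). -/

import Mathlib

/-- A real number is computable if some computable sequence of rationals
approximates it with error at most `(1/2)^n`. -/
def IsComputableReal (x : ℝ) : Prop :=
  ∃ f : ℕ → ℚ, Computable f ∧ ∀ n : ℕ, |x - (f n : ℝ)| ≤ (1 / 2 : ℝ) ^ n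

theorem isComputableReal_ratCast (q : ℚ) : IsComputableReal (q : ℝ) :=
  ⟨fun _ => q, Computable.const q, fun n => by simp⟩

theorem eq_of_forall_abs_sub_le_half_pow {f : ℕ → ℚ} {x y : ℝ}
    (hx : ∀ n : ℕ, |x - (f n : ℝ)| ≤ (1 / 2 : ℝ) ^ n)
    (hy : ∀ n : ℕ, |y - (f n : ℝ)| ≤ (1 / 2 : ℝ) ^ n) : x = y := by
  have lim : ∀ z : ℝ, (∀ n : ℕ, |z - (f n : ℝ)| ≤ (1 / 2 : ℝ) ^ n) →
      Filter.Tendsto (fun n => (f n : ℝ)) Filter.atTop (nhds z) := fun z hz =>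
    tendsto_iff_dist_tendsto_zero.2 <|
      squeeze_zero (fun _ => dist_nonneg)
        (fun n => by rw [dist_comm, Real.dist_eq]; exact hz n)
        (tendsto_pow_atTop_nhds_zero_of_lt_one (by norm_num) (by norm_num))
  exact tendsto_nhds_unique (lim x hx) (lim y hy)

theorem countable_setOf_computable {σ : Type*} [Primcodable σ] :
    {f : ℕ → σ | Computable f}.Countable := by
  let F : {f : ℕ → σ // Computable f} → {g : ℕ → ℕ // Computable g} := fun f =>
    ⟨fun n => Encodable.encode (f.1 n), Computable.encode.comp f.2⟩
  have hF : Function.Injective F := fun f g h =>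
    Subtype.ext <| funext fun n =>
      Encodable.encode_injective (congrFun (congrArg Subtype.val h) n)
  exact hF.countable

theorem countable_setOf_isComputableReal : {x : ℝ | IsComputableReal x}.Countable := by
  choose! f hf happrox using fun x (hx : IsComputableReal x) => hx
  exact Set.MapsTo.countable_of_injOn (f := f) (t := {f : ℕ → ℚ | Computable f})
    (fun x hx => hf x hx)
    (fun x hx y hy h => eq_of_forall_abs_sub_le_half_pow (happrox x hx) (h ▸ happrox y hy))
    countable_setOf_computable

theorem exists_not_isComputableReal_mem_Ioo {a b : ℝ} (hab : a < b) :
    ∃ s ∈ Set.Ioo a b, ¬ IsComputableReal s := by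
  obtain ⟨s, hs, hmem⟩ :=
    (countable_setOf_isComputableReal.dense_compl ℝ).exists_between hab
  exact ⟨s, hmem, hs⟩

/-- Any non-computable real in `(0, 1)` (for instance the limit of a Specker sequence) cuts the
computable unit interval into two nonempty sequentially closed pieces. -/
theorem computable_unit_interval_decomposes_into_two_sequentially_closed_sets :
    ∃ A B : Set ℝ,
      A ∪ B = {x : ℝ | IsComputableReal x ∧ x ∈ Set.Icc (0 : ℝ) 1} ∧
      A ∩ B = ∅ ∧ A.Nonempty ∧ B.Nonempty ∧
      (∀ u : ℕ → ℝ, (∀ n, u n ∈ A) → ∀ x : ℝ, IsComputableReal x →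
          Filter.Tendsto u Filter.atTop (nhds x) → x ∈ A) ∧
      (∀ u : ℕ → ℝ, (∀ n, u n ∈ B) → ∀ x : ℝ, IsComputableReal x →
          Filter.Tendsto u Filter.atTop (nhds x) → x ∈ B) := by
  obtain ⟨s, ⟨hs0, hs1⟩, hs⟩ := exists_not_isComputableReal_mem_Ioo (zero_lt_one' ℝ)
  refine ⟨{x | IsComputableReal x ∧ x ∈ Set.Icc 0 s}, {x | IsComputableReal x ∧ x ∈ Set.Icc s 1},
    ?_, ?_, ⟨0, ?_, le_rfl, hs0.le⟩, ⟨1, ?_, hs1.le, le_rfl⟩, ?_, ?_⟩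
  · rw [← Set.Icc_union_Icc_eq_Icc hs0.le hs1.le]
    ext x
    exact and_or_left.symm
  · refine Set.eq_empty_iff_forall_notMem.2 fun x ⟨⟨hx, hxs⟩, _, hsx⟩ => hs ?_
    rwa [hsx.1.antisymm hxs.2]
  · exact_mod_cast isComputableReal_ratCast 0
  · exact_mod_cast isComputableReal_ratCast 1
  all_goals exact fun u hu x hx hlim =>
    ⟨hx, isClosed_Icc.mem_of_tendsto hlim (Filter.Eventually.of_forall fun n => (hu n).2)⟩
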